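/- Let S be a finite set and let F = (f_s : I_s ⟶ [n])_{s∈S} be an S-claw on [n] in the simplex category Δ. Then F extends to a strongly biCartesian S-cube in Δ if and only if F is compatible. -/

import Mathlib

/-!
Formalization of statements from "Higher Segal spaces via higher excision" (T. Walde).
-/

open CategoryTheory CategoryTheory.Limits SimplexCategory

universe v u

namespace HigherSegal

set_option linter.unusedVariables false
set_option linter.unusedSectionVars false

/-- A morphism of `Δ` is left active if it preserves the minimal element. -/
def IsLeftActive {x y : SimplexCategory} (f : x ⟶ y) : Prop :=
  f.toOrderHom 0 = 0

/-- A morphism of `Δ` is right active if it preserves the maximal element. -/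
def IsRightActive {x y : SimplexCategory} (f : x ⟶ y) : Prop :=
  f.toOrderHom (Fin.last x.len) = Fin.last y.len

/-- A morphism of `Δ` is active if it is both left active and right active. -/
def IsActive {x y : SimplexCategory} (f : x ⟶ y) : Prop :=
  IsLeftActive f ∧ IsRightActive f

/-- A cube `Q : P(S)ᵒᵖ ⥤ Δ` is strongly biCartesian if each of its 2-dimensional faces
(indexed by `T ⊆ S` and distinct `s, s' ∈ S ∖ T`) is both a pullback and a pushout
square in `Δ`. -/
def StronglyBiCartesian {S : Type} [DecidableEq S]
    (Q : (Finset S)ᵒᵖ ⥤ SimplexCategory) : Prop :=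
  ∀ (T : Finset S) (s s' : S), s ∉ T → s' ∉ T → s ≠ s' →
    IsPullback
      (Q.map (homOfLE (Finset.insert_subset_insert s (Finset.subset_insert s' T))).op)
      (Q.map (homOfLE (Finset.subset_insert s (insert s' T))).op)
      (Q.map (homOfLE (Finset.subset_insert s T)).op)
      (Q.map (homOfLE (Finset.subset_insert s' T)).op) ∧
    IsPushout
      (Q.map (homOfLE (Finset.insert_subset_insert s (Finset.subset_insert s' T))).op)
      (Q.map (homOfLE (Finset.subset_insert s (insert s' T))).op)
      (Q.map (homOfLE (Finset.subset_insert s T)).op)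
      (Q.map (homOfLE (Finset.subset_insert s' T)).op)

/-- A cube in `Δ` is left active if all of its morphisms are left active. -/
def LeftActiveCube {S : Type} (Q : (Finset S)ᵒᵖ ⥤ SimplexCategory) : Prop :=
  ∀ {T T' : (Finset S)ᵒᵖ} (g : T ⟶ T'), IsLeftActive (Q.map g)

/-- A cube in `Δ` is right active if all of its morphisms are right active. -/
def RightActiveCube {S : Type} (Q : (Finset S)ᵒᵖ ⥤ SimplexCategory) : Prop :=
  ∀ {T T' : (Finset S)ᵒᵖ} (g : T ⟶ T'), IsRightActive (Q.map g)

/-- An `S`-claw `(f_s : I_s ⟶ x)_{s ∈ S}` in `Δ` is compatible if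
(BC1) for each `i` there is at most one `s` such that the preimage `f_s⁻¹{i}` is not a
singleton, and (BC2) for each pair `{i−1, i}` of consecutive elements there is at most
one `s` such that the pair is not contained in the image of `f_s`. -/
def CompatibleClaw {S : Type} {x : SimplexCategory} {I : S → SimplexCategory}
    (f : ∀ s : S, I s ⟶ x) : Prop :=
  (∀ i : Fin (x.len + 1), ∀ s t : S,
      ¬(∃! a, (f s).toOrderHom a = i) → ¬(∃! a, (f t).toOrderHom a = i) → s = t) ∧
  (∀ i : Fin x.len, ∀ s t : S,
      ¬(i.castSucc ∈ Set.range ⇑(f s).toOrderHom ∧ i.succ ∈ Set.range ⇑(f s).toOrderHom) →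
      ¬(i.castSucc ∈ Set.range ⇑(f t).toOrderHom ∧ i.succ ∈ Set.range ⇑(f t).toOrderHom) →
      s = t)

/-- An `S`-claw is cyclically compatible if it is compatible and all but at most one of
its morphisms contain both the minimal and the maximal element in their image. -/
def CyclicallyCompatibleClaw {S : Type} {x : SimplexCategory} {I : S → SimplexCategory}
    (f : ∀ s : S, I s ⟶ x) : Prop :=
  CompatibleClaw f ∧
  ∀ s t : S,
    ¬((0 : Fin (x.len + 1)) ∈ Set.range ⇑(f s).toOrderHom ∧
        Fin.last x.len ∈ Set.range ⇑(f s).toOrderHom) →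
    ¬((0 : Fin (x.len + 1)) ∈ Set.range ⇑(f t).toOrderHom ∧
        Fin.last x.len ∈ Set.range ⇑(f t).toOrderHom) →
    s = t

/-- An `S`-cube `Q` extends the claw `(f_s : I_s ⟶ [n])_{s ∈ S}` if `Q(∅) = [n]`,
`Q({s}) = I_s` and `Q` sends the inclusion `∅ ⊆ {s}` to `f_s` for every `s ∈ S`. -/
def ExtendsClaw {S : Type} {n : ℕ} {I : S → SimplexCategory}
    (f : ∀ s : S, I s ⟶ SimplexCategory.mk n)
    (Q : (Finset S)ᵒᵖ ⥤ SimplexCategory) : Prop :=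
  ∃ (h0 : Q.obj (Opposite.op (⊥ : Finset S)) = SimplexCategory.mk n)
    (h1 : ∀ s : S, Q.obj (Opposite.op ({s} : Finset S)) = I s),
    ∀ s : S,
      Q.map (homOfLE (bot_le : (⊥ : Finset S) ≤ {s})).op =
        CategoryTheory.eqToHom (h1 s) ≫ f s ≫ CategoryTheory.eqToHom h0.symm

open Classical in
/-- The morphism to `[1]` classifying an upward closed set of elements. -/
noncomputable def cutHom {x : SimplexCategory} (U : Fin (x.len + 1) → Prop) (hU : Monotone U) :
    x ⟶ SimplexCategory.mk 1 :=
  SimplexCategory.Hom.mk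
    { toFun := fun a => if U a then (1 : Fin 2) else 0
      monotone' := fun a b hab => by
        by_cases ha : U a
        · simp [ha, hU hab ha]
        · simp [ha] }

open Classical in
lemma cutHom_apply_eq_one {x : SimplexCategory} {U : Fin (x.len + 1) → Prop} (hU : Monotone U)
    (a : Fin (x.len + 1)) : (cutHom U hU).toOrderHom a = (1 : Fin 2) ↔ U a := by
  change (if U a then (1 : Fin 2) else 0) = 1 ↔ U a
  by_cases ha : U a <;> simp [ha]

open Classical in
lemma comp_cutHom_eq {x y z : SimplexCategory} {f : z ⟶ x} {g : z ⟶ y}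
    {U : Fin (x.len + 1) → Prop} {hU : Monotone U} {V : Fin (y.len + 1) → Prop} {hV : Monotone V}
    (h : ∀ c, U (f.toOrderHom c) ↔ V (g.toOrderHom c)) :
    f ≫ cutHom U hU = g ≫ cutHom V hV := by
  apply SimplexCategory.Hom.ext
  ext c : 2
  change (if U (f.toOrderHom c) then (1 : Fin 2) else 0) =
    if V (g.toOrderHom c) then (1 : Fin 2) else 0
  simp only [h c]

section BiCartesianSquare

variable {p x y z : SimplexCategory} {p₁ : p ⟶ x} {p₂ : p ⟶ y} {f : x ⟶ z} {g : y ⟶ z}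

lemma toOrderHom_comm (w : p₁ ≫ f = p₂ ≫ g) (c : Fin (p.len + 1)) :
    f.toOrderHom (p₁.toOrderHom c) = g.toOrderHom (p₂.toOrderHom c) :=
  congrArg (fun k : p ⟶ z => k.toOrderHom c) w

lemma exists_of_isPullback (hP : IsPullback p₁ p₂ f g) {a : Fin (x.len + 1)}
    {b : Fin (y.len + 1)} (h : f.toOrderHom a = g.toOrderHom b) :
    ∃ c, p₁.toOrderHom c = a ∧ p₂.toOrderHom c = b := by
  obtain ⟨l, hl₁, hl₂⟩ := hP.exists_lift (SimplexCategory.const (SimplexCategory.mk 0) x a)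
    (SimplexCategory.const (SimplexCategory.mk 0) y b) (by
      apply SimplexCategory.Hom.ext
      ext c : 2
      exact h)
  exact ⟨l.toOrderHom 0, congrArg (fun k : SimplexCategory.mk 0 ⟶ x => k.toOrderHom 0) hl₁,
    congrArg (fun k : SimplexCategory.mk 0 ⟶ y => k.toOrderHom 0) hl₂⟩

lemma exists_cut_of_isPushout (hP : IsPushout p₁ p₂ f g) {U : Fin (x.len + 1) → Prop}
    (hU : Monotone U) {V : Fin (y.len + 1) → Prop} (hV : Monotone V)
    (h : ∀ c, U (p₁.toOrderHom c) ↔ V (p₂.toOrderHom c)) :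
    ∃ W : Fin (z.len + 1) → Prop, Monotone W ∧ (∀ a, W (f.toOrderHom a) ↔ U a) ∧
      ∀ b, W (g.toOrderHom b) ↔ V b := by
  obtain ⟨l, hl₁, hl₂⟩ := hP.exists_desc (cutHom U hU) (cutHom V hV) (comp_cutHom_eq h)
  refine ⟨fun i => l.toOrderHom i = (1 : Fin 2), fun i j hij hi => ?_, fun a => ?_, fun b => ?_⟩
  · have h₁ : l.toOrderHom i ≤ l.toOrderHom j := l.toOrderHom.monotone hij
    have h₂ : (l.toOrderHom j : Fin 2) ≤ 1 := Fin.le_last _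
    exact le_antisymm h₂ (hi ▸ h₁)
  · rw [← cutHom_apply_eq_one hU a, ← hl₁]; rfl
  · rw [← cutHom_apply_eq_one hV b, ← hl₂]; rfl

lemma jointly_surjective_of_isPushout (hP : IsPushout p₁ p₂ f g) (i : Fin (z.len + 1)) :
    (∃ a, f.toOrderHom a = i) ∨ ∃ b, g.toOrderHom b = i := by
  by_contra! hi
  have hle : Monotone fun j : Fin (z.len + 1) => i ≤ j := fun _ _ hab h => h.trans hab
  have hlt : Monotone fun j : Fin (z.len + 1) => i < j := fun _ _ hab h => lt_of_lt_of_le h hab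
  have key : cutHom _ hle = cutHom _ hlt :=
    hP.hom_ext (comp_cutHom_eq fun a => (Ne.symm (hi.1 a)).le_iff_lt)
      (comp_cutHom_eq fun b => (Ne.symm (hi.2 b)).le_iff_lt)
  have h := (cutHom_apply_eq_one hle i).2 le_rfl
  rw [key, cutHom_apply_eq_one] at h
  exact lt_irrefl _ h

lemma fiber_subsingleton_of_isPushout (hP : IsPushout p₁ p₂ f g) {i : Fin (z.len + 1)}
    (hi : ∀ a, f.toOrderHom a ≠ i) {b b' : Fin (y.len + 1)} (hb : g.toOrderHom b = i)
    (hb' : g.toOrderHom b' = i) : ¬ b < b' := by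
  intro hlt
  obtain ⟨W, -, -, hW⟩ := exists_cut_of_isPushout hP
    (U := fun a => i < f.toOrderHom a) (V := fun c => b' ≤ c)
    (fun _ _ hab h => lt_of_lt_of_le h (f.toOrderHom.monotone hab))
    (fun _ _ hab h => le_trans h hab) (fun c => by
      have hc := toOrderHom_comm hP.w c
      constructor
      · intro h
        by_contra! h'
        have := g.toOrderHom.monotone h'.le
        rw [hb', ← hc] at this
        exact absurd h this.not_gt
      · intro h
        have := g.toOrderHom.monotone h
        rw [hb', ← hc] at this
        exact lt_of_le_of_ne this (Ne.symm (hi _)))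
  have h₁ := hW b
  have h₂ := hW b'
  rw [hb] at h₁
  rw [hb'] at h₂
  exact absurd (h₁.1 (h₂.2 le_rfl)) hlt.not_ge

lemma existsUnique_fiber_of_isPushout (hP : IsPushout p₁ p₂ f g) {i : Fin (z.len + 1)}
    (hi : ∀ a, f.toOrderHom a ≠ i) : ∃! b, g.toOrderHom b = i := by
  obtain ⟨a, ha⟩ | ⟨b, hb⟩ := jointly_surjective_of_isPushout hP i
  · exact absurd ha (hi a)
  · refine ⟨b, hb, fun b' hb' => le_antisymm ?_ ?_⟩
    · exact not_lt.1 (fiber_subsingleton_of_isPushout hP hi hb hb')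
    · exact not_lt.1 (fiber_subsingleton_of_isPushout hP hi hb' hb)

lemma exists_lt_of_not_existsUnique {α β : Type*} [LinearOrder α] {k : α → β} {i : β} {a : α}
    (ha : k a = i) (h : ¬ ∃! a, k a = i) : ∃ a a', a < a' ∧ k a = i ∧ k a' = i := by
  by_contra! hne
  refine h ⟨a, ha, fun a' ha' => ?_⟩
  by_contra hna
  rcases lt_or_gt_of_ne hna with hlt | hlt
  · exact hne _ _ hlt ha' ha
  · exact hne _ _ hlt ha ha'

lemma existsUnique_fiber_or_of_isPullback_of_isPushout (hP : IsPullback p₁ p₂ f g)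
    (hP' : IsPushout p₁ p₂ f g) (i : Fin (z.len + 1)) :
    (∃! a, f.toOrderHom a = i) ∨ ∃! b, g.toOrderHom b = i := by
  by_cases hf : ∃ a, f.toOrderHom a = i
  swap
  · push Not at hf
    exact Or.inr (existsUnique_fiber_of_isPushout hP' hf)
  by_cases hg : ∃ b, g.toOrderHom b = i
  swap
  · push Not at hg
    exact Or.inl (existsUnique_fiber_of_isPushout hP'.flip hg)
  by_contra! hne
  obtain ⟨a₀, ha₀⟩ := hf
  obtain ⟨b₀, hb₀⟩ := hg
  obtain ⟨a, a', haa, ha, ha'⟩ := exists_lt_of_not_existsUnique ha₀ hne.1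
  obtain ⟨b, b', hbb, hb, hb'⟩ := exists_lt_of_not_existsUnique hb₀ hne.2
  obtain ⟨c, hc₁, hc₂⟩ := exists_of_isPullback hP (ha.trans hb'.symm)
  obtain ⟨d, hd₁, hd₂⟩ := exists_of_isPullback hP (ha'.trans hb.symm)
  rcases le_total c d with hcd | hcd
  · exact absurd (p₂.toOrderHom.monotone hcd) (by rw [hc₂, hd₂]; exact hbb.not_ge)
  · exact absurd (p₁.toOrderHom.monotone hcd) (by rw [hc₁, hd₁]; exact haa.not_ge)

lemma not_missed_crosswise_of_isPushout (hP : IsPushout p₁ p₂ f g) {i : Fin z.len}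
    (hf : ∀ a, f.toOrderHom a ≠ i.castSucc) (hg : ∀ b, g.toOrderHom b ≠ i.succ) : False := by
  obtain ⟨b, hb⟩ : ∃ b, g.toOrderHom b = i.castSucc :=
    (jointly_surjective_of_isPushout hP _).resolve_left fun ⟨a, ha⟩ => hf a ha
  obtain ⟨a, ha⟩ : ∃ a, f.toOrderHom a = i.succ :=
    (jointly_surjective_of_isPushout hP _).resolve_right fun ⟨b, hb⟩ => hg b hb
  obtain ⟨W, hW, hWf, hWg⟩ := exists_cut_of_isPushout hP
    (U := fun a => i.succ < f.toOrderHom a) (V := fun b => i.castSucc ≤ g.toOrderHom b)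
    (fun _ _ hab h => lt_of_lt_of_le h (f.toOrderHom.monotone hab))
    (fun _ _ hab h => le_trans h (g.toOrderHom.monotone hab)) (fun c => by
      have hc := toOrderHom_comm hP.w c
      have h₁ := hf (p₁.toOrderHom c)
      have h₂ := hg (p₂.toOrderHom c)
      rw [← hc] at h₂ ⊢
      generalize f.toOrderHom (p₁.toOrderHom c) = j at *
      simp only [Fin.lt_def, Fin.le_def, Ne, Fin.ext_iff, Fin.val_succ, Fin.val_castSucc] at *
      omega)
  have h₁ : W i.castSucc := hb ▸ (hWg b).2 hb.ge
  have h₂ : ¬ W i.succ := fun h => absurd ((hWf a).1 (ha ▸ h)) (ha ▸ lt_irrefl _)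
  exact h₂ (hW (Fin.castSucc_lt_succ).le h₁)

lemma mem_range_or_of_isPullback_of_isPushout (hP : IsPullback p₁ p₂ f g)
    (hP' : IsPushout p₁ p₂ f g) (i : Fin z.len) :
    (i.castSucc ∈ Set.range f.toOrderHom ∧ i.succ ∈ Set.range f.toOrderHom) ∨
      i.castSucc ∈ Set.range g.toOrderHom ∧ i.succ ∈ Set.range g.toOrderHom := by
  have h₁ := jointly_surjective_of_isPushout hP' i.castSucc
  have h₂ := jointly_surjective_of_isPushout hP' i.succ
  have h₃ := @not_missed_crosswise_of_isPushout _ _ _ _ _ _ _ _ hP' i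
  have h₄ := @not_missed_crosswise_of_isPushout _ _ _ _ _ _ _ _ hP'.flip i
  simp only [Set.mem_range, ← not_exists, exists_prop] at *
  tauto

end BiCartesianSquare

lemma isPullback_isPushout_of_eqToHom {p x y z x' y' z' : SimplexCategory} {p₁ : p ⟶ x}
    {p₂ : p ⟶ y} {f : x ⟶ z} {g : y ⟶ z} {f' : x' ⟶ z'} {g' : y' ⟶ z'}
    (h : IsPullback p₁ p₂ f g ∧ IsPushout p₁ p₂ f g) (hx : x = x') (hy : y = y') (hz : z = z')
    (hf : f = eqToHom hx ≫ f' ≫ eqToHom hz.symm) (hg : g = eqToHom hy ≫ g' ≫ eqToHom hz.symm) :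
    ∃ (p₁ : p ⟶ x') (p₂ : p ⟶ y'), IsPullback p₁ p₂ f' g' ∧ IsPushout p₁ p₂ f' g' := by
  subst hx hy hz
  simp only [eqToHom_refl, Category.comp_id, Category.id_comp] at hf hg
  subst hf hg
  exact ⟨_, _, h⟩

lemma compatibleClaw_of_stronglyBiCartesian {S : Type} [DecidableEq S] {n : ℕ}
    {I : S → SimplexCategory} {f : ∀ s : S, I s ⟶ SimplexCategory.mk n}
    {Q : (Finset S)ᵒᵖ ⥤ SimplexCategory} (hQ : StronglyBiCartesian Q) (hf : ExtendsClaw f Q) :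
    CompatibleClaw f := by
  obtain ⟨h0, h1, hf⟩ := hf
  have key : ∀ s t : S, s ≠ t → ∃ (p : SimplexCategory) (p₁ : p ⟶ I s) (p₂ : p ⟶ I t),
      IsPullback p₁ p₂ (f s) (f t) ∧ IsPushout p₁ p₂ (f s) (f t) := fun s t hst =>
    ⟨_, isPullback_isPushout_of_eqToHom
      (hQ ∅ s t (Finset.notMem_empty s) (Finset.notMem_empty t) hst) (h1 s) (h1 t) h0
      (hf s) (hf t)⟩
  constructor
  · intro i s t hs ht
    by_contra hst
    obtain ⟨p, p₁, p₂, hP, hP'⟩ := key s t hst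
    exact (existsUnique_fiber_or_of_isPullback_of_isPushout hP hP' i).elim hs ht
  · intro i s t hs ht
    by_contra hst
    obtain ⟨p, p₁, p₂, hP, hP'⟩ := key s t hst
    exact (mem_range_or_of_isPullback_of_isPushout hP hP' i).elim hs ht

section OrderSquare

variable {P X Y Z : NonemptyFinLinOrd.{0}} {p₁ : P ⟶ X} {p₂ : P ⟶ Y} {g : X ⟶ Z} {h : Y ⟶ Z}

lemma isPullback_of_bijective (w : p₁ ≫ g = p₂ ≫ h)
    (hinj : ∀ c d : P, p₁ c = p₁ d → p₂ c = p₂ d → c = d)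
    (hsurj : ∀ (a : X) (b : Y), g a = h b → ∃ c, p₁ c = a ∧ p₂ c = b) :
    IsPullback p₁ p₂ g h := by
  refine IsPullback.mk' w (fun T φ φ' h₁ h₂ => ?_) (fun T a b hab => ?_)
  · ext t
    exact hinj _ _ (ConcreteCategory.congr_hom h₁ t) (ConcreteCategory.congr_hom h₂ t)
  · choose l hl₁ hl₂ using fun t : T => hsurj (a t) (b t) (ConcreteCategory.congr_hom hab t)
    refine ⟨NonemptyFinLinOrd.ofHom ⟨l, fun s t hst => ?_⟩, ?_, ?_⟩
    · rcases le_total (l s) (l t) with hle | hle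
      · exact hle
      · refine (hinj _ _ (le_antisymm ?_ (p₁.hom.hom.monotone hle))
          (le_antisymm ?_ (p₂.hom.hom.monotone hle))).le
        · rw [hl₁, hl₁]; exact a.hom.hom.monotone hst
        · rw [hl₂, hl₂]; exact b.hom.hom.monotone hst
    · ext t; exact hl₁ t
    · ext t; exact hl₂ t

lemma isPushout_of_compatible (w : p₁ ≫ g = p₂ ≫ h)
    (hsurj : ∀ (a : X) (b : Y), g a = h b → ∃ c, p₁ c = a ∧ p₂ c = b)
    (hfib : ∀ z, (∃! a, g a = z) ∨ ∃! b, h b = z)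
    (hcov : ∀ z z', z ⋖ z' → (z ∈ Set.range g ∧ z' ∈ Set.range g) ∨
      z ∈ Set.range h ∧ z' ∈ Set.range h) :
    IsPushout p₁ p₂ g h := by
  refine IsPushout.mk' w (fun T φ φ' h₁ h₂ => ?_) (fun T u v huv => ?_)
  · ext z
    obtain ⟨a, rfl, -⟩ | ⟨b, rfl, -⟩ := hfib z
    · exact ConcreteCategory.congr_hom h₁ a
    · exact ConcreteCategory.congr_hom h₂ b
  · have hagree : ∀ a b, g a = h b → u a = v b := by
      intro a b hab
      obtain ⟨c, rfl, rfl⟩ := hsurj a b hab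
      exact ConcreteCategory.congr_hom huv c
    have hval : ∀ z, ∃ x : T, (∀ a, g a = z → u a = x) ∧ ∀ b, h b = z → v b = x := by
      intro z
      rcases hfib z with ⟨a, ha, ha'⟩ | ⟨b, hb, hb'⟩
      · refine ⟨u a, fun a' h' => by rw [ha' a' h'], fun b hb => ?_⟩
        exact (hagree a b (ha.trans hb.symm)).symm
      · refine ⟨v b, fun a ha => hagree a b (ha.trans hb.symm), fun b' h' => by rw [hb' b' h']⟩
    choose k hku hkv using hval
    have hk : Monotone k := by
      classical
      let := Fintype.toLocallyFiniteOrder (α := Z)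
      refine monotone_iff_forall_covBy _ |>.2 fun z z' hz => ?_
      rcases hcov z z' hz with ⟨⟨a, ha⟩, a', ha'⟩ | ⟨⟨b, hb⟩, b', hb'⟩
      · rw [← hku z a ha, ← hku z' a' ha']
        refine u.hom.hom.monotone (le_of_not_gt fun hlt => ?_)
        have := g.hom.hom.monotone hlt.le
        exact absurd (ha'.symm.trans_le (this.trans ha.le)) hz.lt.not_ge
      · rw [← hkv z b hb, ← hkv z' b' hb']
        refine v.hom.hom.monotone (le_of_not_gt fun hlt => ?_)
        have := h.hom.hom.monotone hlt.le
        exact absurd (hb'.symm.trans_le (this.trans hb.le)) hz.lt.not_ge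
    refine ⟨NonemptyFinLinOrd.ofHom ⟨k, hk⟩, ?_, ?_⟩
    · ext a; exact (hku _ a rfl).symm
    · ext b; exact (hkv _ b rfl).symm

end OrderSquare

section FibreProduct

variable {S : Type} {n : ℕ} {I : S → SimplexCategory}

/-- The fibre product over `[n]` of the members of a compatible claw indexed by `T`. -/
@[ext]
structure FibreProduct (f : ∀ s : S, I s ⟶ SimplexCategory.mk n) (hf : CompatibleClaw f)
    (T : Finset S) where
  /-- The underlying element of `[n]`. -/
  base : Fin (n + 1)
  /-- The components indexed by `T`. -/
  comp : ∀ s ∈ T, Fin ((I s).len + 1)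
  apply_comp : ∀ s hs, (f s).toOrderHom (comp s hs) = base

variable {f : ∀ s : S, I s ⟶ SimplexCategory.mk n} {hf : CompatibleClaw f} {T : Finset S}

namespace FibreProduct

instance : PartialOrder (FibreProduct f hf T) where
  le p q := p.base ≤ q.base ∧ ∀ s hs, p.comp s hs ≤ q.comp s hs
  le_refl p := ⟨le_rfl, fun _ _ => le_rfl⟩
  le_trans p q r hpq hqr :=
    ⟨hpq.1.trans hqr.1, fun s hs => (hpq.2 s hs).trans (hqr.2 s hs)⟩
  le_antisymm p q hpq hqp := FibreProduct.ext (le_antisymm hpq.1 hqp.1)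
    (funext fun s => funext fun hs => le_antisymm (hpq.2 s hs) (hqp.2 s hs))

lemma le_of_base_lt {p q : FibreProduct f hf T} (h : p.base < q.base) : p ≤ q := by
  refine ⟨h.le, fun s hs => le_of_not_gt fun hlt => ?_⟩
  have := (f s).toOrderHom.monotone hlt.le
  rw [p.apply_comp, q.apply_comp] at this
  exact absurd h this.not_gt

lemma lt_of_base_lt {p q : FibreProduct f hf T} (h : p.base < q.base) : p < q :=
  lt_of_le_not_ge (le_of_base_lt h) fun h' => absurd h'.1 h.not_ge

lemma le_total_of_base_eq {p q : FibreProduct f hf T} (h : p.base = q.base) :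
    p ≤ q ∨ q ≤ p := by
  by_contra! hne
  have h₁ : ∃ s hs, q.comp s hs < p.comp s hs := by
    by_contra! h'
    exact hne.1 ⟨h.le, h'⟩
  have h₂ : ∃ s hs, p.comp s hs < q.comp s hs := by
    by_contra! h'
    exact hne.2 ⟨h.ge, h'⟩
  have not_unique : ∀ s hs, p.comp s hs ≠ q.comp s hs →
      ¬ ∃! a, (f s).toOrderHom a = p.base := fun s hs hpq hu =>
    hpq (hu.unique (p.apply_comp s hs) ((q.apply_comp s hs).trans h.symm))
  obtain ⟨s, hs, hlt⟩ := h₁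
  obtain ⟨t, ht, hlt'⟩ := h₂
  obtain rfl := hf.1 p.base s t (not_unique s hs hlt.ne') (not_unique t ht hlt'.ne)
  exact lt_asymm hlt hlt'

noncomputable instance : LinearOrder (FibreProduct f hf T) where
  le_total p q := by
    rcases lt_trichotomy p.base q.base with h | h | h
    · exact Or.inl (le_of_base_lt h)
    · exact le_total_of_base_eq h
    · exact Or.inr (le_of_base_lt h)
  toDecidableLE := Classical.decRel _

instance : Finite (FibreProduct f hf T) :=
  Finite.of_injective
    (fun p => (p.base, fun s : T => p.comp s.1 s.2) :
      FibreProduct f hf T → Fin (n + 1) × (∀ s : T, Fin ((I s).len + 1)))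
    fun p q h => FibreProduct.ext (congrArg Prod.fst h)
      (funext fun s => funext fun hs => congrFun (congrArg Prod.snd h) ⟨s, hs⟩)

noncomputable instance : Fintype (FibreProduct f hf T) := Fintype.ofFinite _

lemma exists_base_eq {i : Fin (n + 1)} (h : ∀ s ∈ T, ∃ a, (f s).toOrderHom a = i) :
    ∃ p : FibreProduct f hf T, p.base = i := by
  choose a ha using h
  exact ⟨⟨i, a, ha⟩, rfl⟩

instance : Nonempty (FibreProduct f hf T) := by
  by_contra hemp
  have hmiss : ∀ i, ∃ s ∈ T, ∀ a, (f s).toOrderHom a ≠ i := by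
    by_contra! h
    obtain ⟨i, hi⟩ := h
    exact hemp ⟨(exists_base_eq hi).choose⟩
  obtain ⟨s, -, hs⟩ := hmiss 0
  have hall : ∀ i : Fin (n + 1), ∀ a, (f s).toOrderHom a ≠ i := by
    intro i
    induction i using Fin.induction with
    | zero => exact hs
    | succ i ih =>
      obtain ⟨t, -, ht⟩ := hmiss i.succ
      obtain rfl := hf.2 i s t (fun ⟨⟨a, ha⟩, _⟩ => ih a ha) (fun ⟨_, ⟨a, ha⟩⟩ => ht a ha)
      exact ht
  exact hall _ 0 rfl

/-- Forgetting the components outside of a smaller index set. -/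
def restrict {T T' : Finset S} (h : T' ⊆ T) : FibreProduct f hf T →o FibreProduct f hf T' where
  toFun p := ⟨p.base, fun s hs => p.comp s (h hs), fun s hs => p.apply_comp s (h hs)⟩
  monotone' _ _ hpq := ⟨hpq.1, fun s hs => hpq.2 s (h hs)⟩

lemma eq_of_restrict_eq {T T₁ T₂ : Finset S} (h₁ : T₁ ⊆ T) (h₂ : T₂ ⊆ T)
    (h : ∀ s ∈ T, s ∈ T₁ ∨ s ∈ T₂) {p q : FibreProduct f hf T}
    (hp : restrict h₁ p = restrict h₁ q) (hq : restrict h₂ p = restrict h₂ q) : p = q := by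
  have hbase := congrArg base hp
  refine FibreProduct.ext hbase (funext fun s => funext fun hs => ?_)
  rcases h s hs with h' | h'
  · exact congrArg (fun r => r.comp s h') hp
  · exact congrArg (fun r => r.comp s h') hq

lemma exists_glue {T T₁ T₂ : Finset S} (h₁ : T₁ ⊆ T) (h₂ : T₂ ⊆ T)
    (h : ∀ s ∈ T, s ∈ T₁ ∨ s ∈ T₂) (p : FibreProduct f hf T₁) (q : FibreProduct f hf T₂)
    (hbase : p.base = q.base) (hcomp : ∀ s hs₁ hs₂, p.comp s hs₁ = q.comp s hs₂) :
    ∃ r : FibreProduct f hf T, restrict h₁ r = p ∧ restrict h₂ r = q := by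
  classical
  refine ⟨⟨p.base, fun s hs => if hs₁ : s ∈ T₁ then p.comp s hs₁ else
    q.comp s ((h s hs).resolve_left hs₁), fun s hs => ?_⟩, ?_, ?_⟩
  · split_ifs with hs₁
    · exact p.apply_comp s hs₁
    · exact (q.apply_comp _ _).trans hbase.symm
  · refine FibreProduct.ext rfl (funext fun s => funext fun hs => ?_)
    exact dif_pos hs
  · refine FibreProduct.ext hbase (funext fun s => funext fun hs => ?_)
    change dite _ _ _ = _
    split_ifs with hs₁
    · exact hcomp s hs₁ hs
    · rfl

/-- The fibre product over an empty index set is `[n]`. -/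
def emptyIso : FibreProduct f hf ∅ ≃o Fin (n + 1) where
  toFun p := p.base
  invFun i := ⟨i, fun s hs => absurd hs (Finset.notMem_empty s),
    fun s hs => absurd hs (Finset.notMem_empty s)⟩
  left_inv p := FibreProduct.ext rfl
    (funext fun s => funext fun hs => absurd hs (Finset.notMem_empty s))
  right_inv i := rfl
  map_rel_iff' := ⟨fun h => ⟨h, fun s hs => absurd hs (Finset.notMem_empty s)⟩, fun h => h.1⟩

/-- The elements of the fibre product over a single index `s`. -/
def single (s : S) (a : Fin ((I s).len + 1)) : FibreProduct f hf {s} :=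
  ⟨(f s).toOrderHom a, fun t ht => (Finset.mem_singleton.1 ht) ▸ a, fun t ht => by
    obtain rfl := Finset.mem_singleton.1 ht
    rfl⟩

/-- The fibre product over a single index `s` is `I s`. -/
def singletonIso (s : S) : FibreProduct f hf {s} ≃o Fin ((I s).len + 1) where
  toFun p := p.comp s (Finset.mem_singleton_self s)
  invFun a := single s a
  left_inv p := FibreProduct.ext (p.apply_comp s _) (funext fun t => funext fun ht => by
    obtain rfl := Finset.mem_singleton.1 ht
    rfl)
  right_inv a := rfl
  map_rel_iff' := by
    intro p q
    refine ⟨fun h => ⟨?_, fun t ht => ?_⟩, fun h => h.2 s _⟩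
    · rw [← p.apply_comp s (Finset.mem_singleton_self s),
        ← q.apply_comp s (Finset.mem_singleton_self s)]
      exact (f s).toOrderHom.monotone h
    · obtain rfl := Finset.mem_singleton.1 ht
      exact h

variable [DecidableEq S]

lemma exists_restrict_insert_eq {s : S} (hs : s ∉ T) (p : FibreProduct f hf T)
    {a : Fin ((I s).len + 1)} (ha : (f s).toOrderHom a = p.base) :
    ∃ q : FibreProduct f hf (insert s T), restrict (Finset.subset_insert s T) q = p ∧
      q.comp s (Finset.mem_insert_self s T) = a := by
  obtain ⟨q, hq, hq'⟩ := exists_glue (T := insert s T) (Finset.subset_insert s T)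
    (Finset.singleton_subset_iff.2 (Finset.mem_insert_self s T))
    (fun t ht => (Finset.mem_insert.1 ht).symm.imp_right Finset.mem_singleton.2) p (single s a)
    ha.symm (fun t ht ht' => absurd (Finset.mem_singleton.1 ht' ▸ ht) hs)
  exact ⟨q, hq, congrArg (singletonIso s) hq'⟩

lemma existsUnique_restrict_insert_eq {s : S} (hs : s ∉ T) (p : FibreProduct f hf T)
    (hu : ∃! a, (f s).toOrderHom a = p.base) :
    ∃! q : FibreProduct f hf (insert s T), restrict (Finset.subset_insert s T) q = p := by
  obtain ⟨a, ha, -⟩ := id hu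
  obtain ⟨q, hq, -⟩ := exists_restrict_insert_eq hs p ha
  refine ⟨q, hq, fun q' hq' => ?_⟩
  refine eq_of_restrict_eq (Finset.subset_insert s T)
    (Finset.singleton_subset_iff.2 (Finset.mem_insert_self s T))
    (fun t ht => (Finset.mem_insert.1 ht).symm.imp_right Finset.mem_singleton.2)
    (hq'.trans hq.symm) ((singletonIso s).injective ?_)
  exact hu.unique ((q'.apply_comp s _).trans (congrArg base hq'))
    ((q.apply_comp s _).trans (congrArg base hq))

lemma mem_range_or_of_covBy {s t : S} (hs : s ∉ T) (ht : t ∉ T) (hst : s ≠ t)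
    {p q : FibreProduct f hf T} (hpq : p ⋖ q) :
    (p.base ∈ Set.range (f s).toOrderHom ∧ q.base ∈ Set.range (f s).toOrderHom) ∨
      p.base ∈ Set.range (f t).toOrderHom ∧ q.base ∈ Set.range (f t).toOrderHom := by
  have hfib : ∀ i, i ∈ Set.range (f s).toOrderHom ∨ i ∈ Set.range (f t).toOrderHom := by
    intro i
    by_contra! h
    exact hst (hf.1 i s t (fun h' => h.1 h'.exists) (fun h' => h.2 h'.exists))
  rcases hpq.le.1.eq_or_lt with heq | hlt
  · rw [← heq]
    exact (hfib p.base).imp (fun h => ⟨h, h⟩) (fun h => ⟨h, h⟩)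
  obtain ⟨i, hi⟩ : ∃ i : Fin n, i.castSucc = p.base :=
    ⟨p.base.castLT (lt_of_lt_of_le hlt (Fin.le_last q.base)), rfl⟩
  by_cases hq : q.base = i.succ
  · rw [← hi, hq]
    by_contra! h
    exact hst (hf.2 i s t (fun h' => h.1 h'.1 h'.2) (fun h' => h.2 h'.1 h'.2))
  obtain ⟨r, hr, hmiss⟩ : ∃ r ∈ T, i.succ ∉ Set.range (f r).toOrderHom := by
    by_contra! hall
    obtain ⟨m, hm⟩ := exists_base_eq (hf := hf) hall
    have hlt₁ : p.base < m.base := by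
      rw [hm, ← hi]
      exact Fin.castSucc_lt_succ
    have hlt₂ : m.base < q.base := by
      rw [← hi] at hlt
      rw [hm]
      exact lt_of_le_of_ne (Fin.castSucc_lt_iff_succ_le.1 hlt) (Ne.symm hq)
    exact hpq.2 (lt_of_base_lt hlt₁) (lt_of_base_lt hlt₂)
  have hp : ∀ u, u ∉ T → p.base ∈ Set.range (f u).toOrderHom := by
    intro u hu
    by_contra h
    obtain rfl := hf.2 i u r (fun h' => h (hi ▸ h'.1)) (fun h' => hmiss h'.2)
    exact hu hr
  exact (hfib q.base).imp (fun h => ⟨hp s hs, h⟩) (fun h => ⟨hp t ht, h⟩)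

variable (f hf) in
/-- The cube of fibre products of a compatible claw. -/
noncomputable def cube : (Finset S)ᵒᵖ ⥤ NonemptyFinLinOrd.{0} where
  obj T := NonemptyFinLinOrd.of (FibreProduct f hf T.unop)
  map g := NonemptyFinLinOrd.ofHom (restrict (leOfHom g.unop))

lemma cube_isPullback_isPushout {s t : S} (hs : s ∉ T) (ht : t ∉ T) (hst : s ≠ t) :
    IsPullback
      ((cube f hf).map (homOfLE (Finset.insert_subset_insert s (Finset.subset_insert t T))).op)
      ((cube f hf).map (homOfLE (Finset.subset_insert s (insert t T))).op)
      ((cube f hf).map (homOfLE (Finset.subset_insert s T)).op)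
      ((cube f hf).map (homOfLE (Finset.subset_insert t T)).op) ∧
    IsPushout
      ((cube f hf).map (homOfLE (Finset.insert_subset_insert s (Finset.subset_insert t T))).op)
      ((cube f hf).map (homOfLE (Finset.subset_insert s (insert t T))).op)
      ((cube f hf).map (homOfLE (Finset.subset_insert s T)).op)
      ((cube f hf).map (homOfLE (Finset.subset_insert t T)).op) := by
  have hunion : ∀ r ∈ insert s (insert t T), r ∈ insert s T ∨ r ∈ insert t T := by
    intro r
    simp only [Finset.mem_insert]
    tauto
  have hsurj : ∀ (p : FibreProduct f hf (insert s T)) (q : FibreProduct f hf (insert t T)),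
      restrict (Finset.subset_insert s T) p = restrict (Finset.subset_insert t T) q →
      ∃ r : FibreProduct f hf (insert s (insert t T)),
        restrict (Finset.insert_subset_insert s (Finset.subset_insert t T)) r = p ∧
        restrict (Finset.subset_insert s (insert t T)) r = q := by
    intro p q hpq
    refine exists_glue _ _ hunion p q (congrArg base hpq) fun r hr hr' => ?_
    have hrT : r ∈ T := by
      rcases Finset.mem_insert.1 hr with rfl | h
      · exact (Finset.mem_insert.1 hr').resolve_left hst
      · exact h
    exact congrArg (fun m => m.comp r hrT) hpq
  have hw : (cube f hf).map (homOfLE (Finset.insert_subset_insert s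
        (Finset.subset_insert t T))).op ≫ (cube f hf).map (homOfLE (Finset.subset_insert s T)).op =
      (cube f hf).map (homOfLE (Finset.subset_insert s (insert t T))).op ≫
        (cube f hf).map (homOfLE (Finset.subset_insert t T)).op := rfl
  refine ⟨isPullback_of_bijective hw
    (fun p q h₁ h₂ => eq_of_restrict_eq (f := f) (hf := hf) _ _ hunion h₁ h₂) hsurj,
    isPushout_of_compatible hw hsurj (fun p => ?_) (fun p q hpq => ?_)⟩
  · by_cases h : ∃! a, (f s).toOrderHom a = base p
    · exact Or.inl (existsUnique_restrict_insert_eq hs p h)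
    · refine Or.inr (existsUnique_restrict_insert_eq ht p ?_)
      by_contra h'
      exact hst (hf.1 _ s t h h')
  · refine (mem_range_or_of_covBy hs ht hst hpq).imp ?_ ?_
    · rintro ⟨⟨a, ha⟩, b, hb⟩
      obtain ⟨p', hp', -⟩ := exists_restrict_insert_eq hs p ha
      obtain ⟨q', hq', -⟩ := exists_restrict_insert_eq hs q hb
      exact ⟨⟨p', hp'⟩, q', hq'⟩
    · rintro ⟨⟨a, ha⟩, b, hb⟩
      obtain ⟨p', hp', -⟩ := exists_restrict_insert_eq ht p ha
      obtain ⟨q', hq', -⟩ := exists_restrict_insert_eq ht q hb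
      exact ⟨⟨p', hp'⟩, q', hq'⟩

end FibreProduct

end FibreProduct

/-- Isomorphic objects of the simplex category are equal, and the isomorphism is the identity. -/
lemma exists_iso_hom_eq_eqToHom {x y : SimplexCategory} (e : x ≅ y) :
    ∃ h : x = y, e.hom = eqToHom h := by
  obtain rfl := SimplexCategory.skeletal ⟨e⟩
  exact ⟨rfl, SimplexCategory.eq_id_of_isIso e.hom⟩

lemma extendsClaw_of_iso {S : Type} {n : ℕ} {I : S → SimplexCategory}
    {f : ∀ s : S, I s ⟶ SimplexCategory.mk n} {Q : (Finset S)ᵒᵖ ⥤ SimplexCategory}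
    (e₀ : Q.obj (Opposite.op ⊥) ≅ SimplexCategory.mk n)
    (e : ∀ s, Q.obj (Opposite.op {s}) ≅ I s)
    (h : ∀ s, Q.map (homOfLE (bot_le : (⊥ : Finset S) ≤ {s})).op ≫ e₀.hom = (e s).hom ≫ f s) :
    ExtendsClaw f Q := by
  obtain ⟨h₀, he₀⟩ := exists_iso_hom_eq_eqToHom e₀
  choose h₁ he using fun s => exists_iso_hom_eq_eqToHom (e s)
  refine ⟨h₀, h₁, fun s => ?_⟩
  rw [← Category.assoc, ← he s, ← h s, he₀]
  simp

lemma inverse_map_comp_unitInv {C D : Type*} [Category* C] [Category* D] (E : C ≌ D) {A B : D}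
    {x y : C} {u : A ⟶ B} {a : A ⟶ E.functor.obj x} {b : B ⟶ E.functor.obj y} {f : x ⟶ y}
    (h : u ≫ b = a ≫ E.functor.map f) :
    E.inverse.map u ≫ E.inverse.map b ≫ E.unitInv.app y =
      (E.inverse.map a ≫ E.unitInv.app x) ≫ f := by
  rw [← Functor.map_comp_assoc, h, Functor.map_comp_assoc, Category.assoc]
  congr 1
  exact E.unitInv.naturality f

lemma exists_stronglyBiCartesian_of_compatibleClaw {S : Type} [DecidableEq S] {n : ℕ}
    {I : S → SimplexCategory} {f : ∀ s : S, I s ⟶ SimplexCategory.mk n} (hf : CompatibleClaw f) :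
    ∃ Q : (Finset S)ᵒᵖ ⥤ SimplexCategory, StronglyBiCartesian Q ∧ ExtendsClaw f Q := by
  let E := SimplexCategory.skeletalEquivalence
  refine ⟨FibreProduct.cube f hf ⋙ E.inverse, fun T s t hs ht hst => ?_,
    extendsClaw_of_iso
      (E.inverse.mapIso (NonemptyFinLinOrd.Iso.mk
        (β := SimplexCategory.skeletalFunctor.obj (SimplexCategory.mk n))
        (FibreProduct.emptyIso (hf := hf))) ≪≫ (E.unitIso.app _).symm)
      (fun s => E.inverse.mapIso (NonemptyFinLinOrd.Iso.mk
        (β := SimplexCategory.skeletalFunctor.obj (I s))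
        (FibreProduct.singletonIso (hf := hf) s)) ≪≫ (E.unitIso.app _).symm)
      (fun s => ?_)⟩
  · have h := FibreProduct.cube_isPullback_isPushout (f := f) (hf := hf) hs ht hst
    exact ⟨h.1.map E.inverse, h.2.map E.inverse⟩
  · have key : (FibreProduct.cube f hf).map (homOfLE (bot_le : (⊥ : Finset S) ≤ {s})).op ≫
          NonemptyFinLinOrd.ofHom (FibreProduct.emptyIso (hf := hf) : _ →o _) =
        NonemptyFinLinOrd.ofHom (FibreProduct.singletonIso (hf := hf) s : _ →o _) ≫
          SimplexCategory.skeletalFunctor.map (f s) := by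
      ext p
      exact congrArg Fin.val (FibreProduct.apply_comp p s (Finset.mem_singleton_self s)).symm
    exact inverse_map_comp_unitInv E key

/-- An `S`-claw on `[n]` in `Δ` extends to a strongly biCartesian
`S`-cube in `Δ` if and only if it is compatible. -/
theorem claw_extends_iff_compatible {S : Type} [Fintype S] [DecidableEq S]
    {n : ℕ} {I : S → SimplexCategory} (f : ∀ s : S, I s ⟶ SimplexCategory.mk n) :
    (∃ Q : (Finset S)ᵒᵖ ⥤ SimplexCategory, StronglyBiCartesian Q ∧ ExtendsClaw f Q) ↔
      CompatibleClaw f := by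
  exact ⟨fun ⟨_, hQ, hfQ⟩ => compatibleClaw_of_stronglyBiCartesian hQ hfQ,
    exists_stronglyBiCartesian_of_compatibleClaw⟩

end HigherSegal
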